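/- Let α ≥ 0 be an admissible exponent of A with associated sequence (M_n), and suppose G_α is invertible on c00(α) with c_α := ‖G_α^{−1}‖ > 0. Then ‖A(m,n)‖ ≤ 2[c_α(e^α − 1) + 1] M_n e^{−(m−n)/(2c_α)} for all m ≥ n in ℕ; in particular A is nonuniform exponentially stable. -/

import Mathlib

open Filter Topology

variable {E : Type*} [NormedAddCommGroup E] [NormedSpace ℝ E] [CompleteSpace E]

/-- `evol A n m` is the evolution operator `A(m,n) = A_{m-1} ∘ ⋯ ∘ A_n`
(the identity if `m ≤ n`). -/
def evol (A : ℕ → E →L[ℝ] E) (n : ℕ) : ℕ → E →L[ℝ] E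
  | 0 => 1
  | m + 1 => if n ≤ m then A m * evol A n m else 1

/-- `α` is an admissible exponent for `A`: there is a positive sequence `M` with
`‖A(m,n)‖ ≤ M n * e^{α (m - n)}` for all `m ≥ n`. -/
def IsAdmissible (A : ℕ → E →L[ℝ] E) (α : ℝ) : Prop :=
  ∃ M : ℕ → ℝ, (∀ n, 0 < M n) ∧
    ∀ m n : ℕ, n ≤ m → ‖evol A n m‖ ≤ M n * Real.exp (α * ((m : ℝ) - (n : ℝ)))

/-- The norm `‖x‖_{n,α} = sup_{m ≥ n} e^{-α(m-n)} ‖A(m,n) x‖`. -/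
noncomputable def nnorm (A : ℕ → E →L[ℝ] E) (α : ℝ) (n : ℕ) (x : E) : ℝ :=
  ⨆ m : Set.Ici n, Real.exp (-α * (((m : ℕ) : ℝ) - (n : ℝ))) * ‖evol A n (m : ℕ) x‖

/-- Membership in `c00(α)`: `u 0 = 0` and `‖u n‖_{n,α} → 0`. -/
def MemC00 (A : ℕ → E →L[ℝ] E) (α : ℝ) (u : ℕ → E) : Prop :=
  u 0 = 0 ∧ Tendsto (fun n => nnorm A α n (u n)) atTop (𝓝 0)

/-- The norm `‖u‖_α = sup_n ‖u n‖_{n,α}` on `c00(α)`. -/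
noncomputable def cnorm (A : ℕ → E →L[ℝ] E) (α : ℝ) (u : ℕ → E) : ℝ :=
  ⨆ n, nnorm A α n (u n)

/-- The evolution map `T`: `(Tu)_0 = 0`, `(Tu)_{n+1} = A_n u_n`. -/
def Tmap (A : ℕ → E →L[ℝ] E) (u : ℕ → E) : ℕ → E
  | 0 => 0
  | m + 1 => A m (u m)

/-- `G = T - Id`. -/
def Gmap (A : ℕ → E →L[ℝ] E) (u : ℕ → E) : ℕ → E :=
  fun n => Tmap A u n - u n

set_option linter.unusedSectionVars false

lemma evol_self (A : ℕ → E →L[ℝ] E) (n : ℕ) : evol A n n = 1 := by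
  cases n <;> simp [evol]

lemma evol_succ (A : ℕ → E →L[ℝ] E) {n m : ℕ} (h : n ≤ m) :
    evol A n (m + 1) = A m * evol A n m := by
  simp [evol, h]

lemma evol_comp (A : ℕ → E →L[ℝ] E) {n k m : ℕ} (hnk : n ≤ k) (hkm : k ≤ m) :
    evol A n m = evol A k m * evol A n k := by
  induction m, hkm using Nat.le_induction with
  | base => simp [evol_self]
  | succ m hkm ih => rw [evol_succ A (hnk.trans hkm), evol_succ A hkm, ih, mul_assoc]

lemma nnorm_nonneg (A : ℕ → E →L[ℝ] E) (α : ℝ) (n : ℕ) (x : E) : 0 ≤ nnorm A α n x :=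
  Real.iSup_nonneg fun _ => by positivity

lemma nnorm_smul (A : ℕ → E →L[ℝ] E) (α : ℝ) (n : ℕ) (r : ℝ) (x : E) :
    nnorm A α n (r • x) = |r| * nnorm A α n x := by
  unfold nnorm
  rw [Real.mul_iSup_of_nonneg (abs_nonneg r)]
  congr 1
  ext m
  rw [map_smul, norm_smul, Real.norm_eq_abs]
  ring

lemma nnorm_zero (A : ℕ → E →L[ℝ] E) (α : ℝ) (n : ℕ) : nnorm A α n 0 = 0 := by
  simp [nnorm]

section Bounded

variable {A : ℕ → E →L[ℝ] E} {α : ℝ} {M : ℕ → ℝ}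

lemma exp_mul_norm_evol_le
    (hbd : ∀ m n : ℕ, n ≤ m → ‖evol A n m‖ ≤ M n * Real.exp (α * ((m : ℝ) - (n : ℝ))))
    {n m : ℕ} (h : n ≤ m) (x : E) :
    Real.exp (-α * ((m : ℝ) - (n : ℝ))) * ‖evol A n m x‖ ≤ M n * ‖x‖ := by
  calc Real.exp (-α * ((m : ℝ) - (n : ℝ))) * ‖evol A n m x‖
      ≤ Real.exp (-α * ((m : ℝ) - (n : ℝ))) *
          (M n * Real.exp (α * ((m : ℝ) - (n : ℝ))) * ‖x‖) := by
        gcongr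
        exact (evol A n m).le_of_opNorm_le (hbd m n h) x
    _ = (Real.exp (-α * ((m : ℝ) - (n : ℝ))) * Real.exp (α * ((m : ℝ) - (n : ℝ)))) *
          (M n * ‖x‖) := by ring
    _ = M n * ‖x‖ := by
        rw [← Real.exp_add]
        simp

lemma nnorm_le
    (hbd : ∀ m n : ℕ, n ≤ m → ‖evol A n m‖ ≤ M n * Real.exp (α * ((m : ℝ) - (n : ℝ))))
    (n : ℕ) (x : E) : nnorm A α n x ≤ M n * ‖x‖ :=
  have : Nonempty (Set.Ici n) := ⟨⟨n, Set.mem_Ici.2 le_rfl⟩⟩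
  ciSup_le fun m => exp_mul_norm_evol_le hbd m.2 x

lemma exp_mul_norm_evol_le_nnorm
    (hbd : ∀ m n : ℕ, n ≤ m → ‖evol A n m‖ ≤ M n * Real.exp (α * ((m : ℝ) - (n : ℝ))))
    {n m : ℕ} (h : n ≤ m) (x : E) :
    Real.exp (-α * ((m : ℝ) - (n : ℝ))) * ‖evol A n m x‖ ≤ nnorm A α n x := by
  refine le_ciSup (f := fun m : Set.Ici n =>
    Real.exp (-α * (((m : ℕ) : ℝ) - (n : ℝ))) * ‖evol A n (m : ℕ) x‖) ?_ ⟨m, h⟩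
  refine ⟨M n * ‖x‖, ?_⟩
  rintro _ ⟨k, rfl⟩
  exact exp_mul_norm_evol_le hbd k.2 x

lemma norm_le_nnorm
    (hbd : ∀ m n : ℕ, n ≤ m → ‖evol A n m‖ ≤ M n * Real.exp (α * ((m : ℝ) - (n : ℝ))))
    (n : ℕ) (x : E) : ‖x‖ ≤ nnorm A α n x := by
  simpa [evol_self] using exp_mul_norm_evol_le_nnorm hbd (le_refl n) x

lemma nnorm_evol_le
    (hbd : ∀ m n : ℕ, n ≤ m → ‖evol A n m‖ ≤ M n * Real.exp (α * ((m : ℝ) - (n : ℝ))))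
    (n i : ℕ) (x : E) :
    nnorm A α (n + i) (evol A n (n + i) x) ≤ Real.exp (α * i) * nnorm A α n x := by
  have : Nonempty (Set.Ici (n + i)) := ⟨⟨n + i, Set.mem_Ici.2 le_rfl⟩⟩
  refine ciSup_le ?_
  rintro ⟨m, hm⟩
  rw [Set.mem_Ici] at hm
  have h1 := exp_mul_norm_evol_le_nnorm hbd ((Nat.le_add_right n i).trans hm) x
  rw [evol_comp A (Nat.le_add_right n i) hm, mul_apply_eq_comp] at h1
  calc _ = Real.exp (α * i) * (Real.exp (-α * ((m : ℝ) - (n : ℝ))) *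
            ‖evol A (n + i) m (evol A n (n + i) x)‖) := by
        rw [← mul_assoc, ← Real.exp_add]
        push_cast
        ring_nf
    _ ≤ _ := by gcongr

end Bounded

lemma eq_of_Gmap_eq {A : ℕ → E →L[ℝ] E} {u w : ℕ → E} (h0 : u 0 = w 0)
    (h : Gmap A u = Gmap A w) : u = w := by
  funext k
  induction k with
  | zero => exact h0
  | succ k ih =>
    have := congrFun h (k + 1)
    simpa [Gmap, Tmap, ih] using this

/-- The orbit of `x` started at time `n`, weighted by `φ`, and zero before time `n`. -/
def weightedOrbit (A : ℕ → E →L[ℝ] E) (n : ℕ) (φ : ℕ → ℝ) (x : E) (k : ℕ) : E :=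
  if n ≤ k then φ (k - n) • evol A n k x else 0

lemma weightedOrbit_add (A : ℕ → E →L[ℝ] E) (n : ℕ) (φ : ℕ → ℝ) (x : E) (i : ℕ) :
    weightedOrbit A n φ x (n + i) = φ i • evol A n (n + i) x := by
  simp [weightedOrbit]

lemma Gmap_weightedOrbit_of_le (A : ℕ → E →L[ℝ] E) {n : ℕ} {φ : ℕ → ℝ} (hφ : φ 0 = 0) (x : E)
    {k : ℕ} (hk : k ≤ n) : Gmap A (weightedOrbit A n φ x) k = 0 := by
  have hw : ∀ j ≤ n, weightedOrbit A n φ x j = 0 := by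
    intro j hj
    rcases hj.lt_or_eq with h | rfl
    · simp [weightedOrbit, h.not_ge]
    · simp [weightedOrbit, hφ]
  cases k with
  | zero => simp [Gmap, Tmap, hw 0 hk]
  | succ k => simp [Gmap, Tmap, hw _ hk, hw k (by omega)]

lemma Gmap_weightedOrbit_add (A : ℕ → E →L[ℝ] E) (n : ℕ) (φ : ℕ → ℝ) (x : E) (i : ℕ) :
    Gmap A (weightedOrbit A n φ x) (n + (i + 1)) =
      (φ i - φ (i + 1)) • evol A n (n + (i + 1)) x := by
  have h : Gmap A (weightedOrbit A n φ x) (n + (i + 1)) =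
      A (n + i) (weightedOrbit A n φ x (n + i)) - weightedOrbit A n φ x (n + (i + 1)) := rfl
  rw [h, weightedOrbit_add, weightedOrbit_add, map_smul, ← add_assoc,
    evol_succ A (Nat.le_add_right n i), mul_apply_eq_comp, sub_smul]

/-- Boundedness of the inverse of `G`, tested on weighted orbits whose weights vanish at `0` and
are eventually constant. -/
lemma abs_mul_nnorm_evol_le {A : ℕ → E →L[ℝ] E} {α c : ℝ} (hc : 0 < c)
    (hsurj : ∀ v, MemC00 A α v → ∃ u, MemC00 A α u ∧ Gmap A u = v)
    (hinv : ∀ u, MemC00 A α u → cnorm A α u ≤ c * cnorm A α (Gmap A u))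
    (n : ℕ) (x : E) {φ : ℕ → ℝ} (hφ : φ 0 = 0) {N : ℕ}
    (hN : ∀ i, N ≤ i → φ (i + 1) = φ i) {B : ℝ} (hB0 : 0 ≤ B)
    (hB : ∀ i < N, |φ i - φ (i + 1)| *
      nnorm A α (n + (i + 1)) (evol A n (n + (i + 1)) x) ≤ B) (i : ℕ) :
    |φ i| * nnorm A α (n + i) (evol A n (n + i) x) ≤ c * B := by
  set w := weightedOrbit A n φ x with hw
  have hw0 : w 0 = 0 := by
    have := Gmap_weightedOrbit_of_le A hφ x (Nat.zero_le n)
    simpa [Gmap, Tmap] using this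
  have hG : ∀ k, nnorm A α k (Gmap A w k) ≤ B := by
    intro k
    rcases le_or_gt k n with hk | hk
    · rw [hw, Gmap_weightedOrbit_of_le A hφ x hk, nnorm_zero]
      exact hB0
    · obtain ⟨i, rfl⟩ := Nat.exists_eq_add_of_lt hk
      rw [add_assoc, hw, Gmap_weightedOrbit_add, nnorm_smul]
      rcases lt_or_ge i N with hi | hi
      · exact hB i hi
      · simpa [hN i hi] using hB0
  have hmemG : MemC00 A α (Gmap A w) := by
    refine ⟨Gmap_weightedOrbit_of_le A hφ x (Nat.zero_le n), ?_⟩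
    refine tendsto_const_nhds.congr' ?_
    filter_upwards [eventually_ge_atTop (n + N + 1)] with k hk
    obtain ⟨i, rfl⟩ := Nat.exists_eq_add_of_lt (show n < k by omega)
    rw [add_assoc, hw, Gmap_weightedOrbit_add, hN i (by omega), sub_self, zero_smul, nnorm_zero]
  obtain ⟨u, hu, huG⟩ := hsurj _ hmemG
  have huw : u = w := eq_of_Gmap_eq (hu.1.trans hw0.symm) huG
  rw [huw] at hu
  calc |φ i| * nnorm A α (n + i) (evol A n (n + i) x)
      = nnorm A α (n + i) (w (n + i)) := by rw [hw, weightedOrbit_add, nnorm_smul]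
    _ ≤ cnorm A α w := le_ciSup (f := fun k => nnorm A α k (w k)) hu.2.bddAbove_range (n + i)
    _ ≤ c * cnorm A α (Gmap A w) := hinv w hu
    _ ≤ c * B := by
        gcongr
        exact ciSup_le hG

/-- Uniform boundedness of the orbits in the norms `nnorm`. -/
lemma nnorm_evol_le_const_mul {A : ℕ → E →L[ℝ] E} {α c : ℝ} {M : ℕ → ℝ} (hα0 : 0 ≤ α)
    (hbd : ∀ m n : ℕ, n ≤ m → ‖evol A n m‖ ≤ M n * Real.exp (α * ((m : ℝ) - (n : ℝ))))
    (hc : 0 < c)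
    (hsurj : ∀ v, MemC00 A α v → ∃ u, MemC00 A α u ∧ Gmap A u = v)
    (hinv : ∀ u, MemC00 A α u → cnorm A α u ≤ c * cnorm A α (Gmap A u))
    (n i : ℕ) (x : E) :
    nnorm A α (n + i) (evol A n (n + i) x) ≤ (c * (Real.exp α - 1) + 1) * nnorm A α n x := by
  have hdecay : ∀ j : ℕ, Real.exp (-α * j) * nnorm A α (n + j) (evol A n (n + j) x) ≤
      nnorm A α n x := by
    intro j
    calc _ ≤ Real.exp (-α * j) * (Real.exp (α * j) * nnorm A α n x) := by
          gcongr
          exact nnorm_evol_le hbd n j x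
      _ = nnorm A α n x := by
          rw [← mul_assoc, ← Real.exp_add]
          simp
  have hexp : 0 ≤ Real.exp α - 1 := by linarith [Real.one_le_exp hα0]
  have key := abs_mul_nnorm_evol_le hc hsurj hinv n x
    (φ := fun j => 1 - Real.exp (-α * (min j i : ℕ))) (by simp) (N := i)
    (fun j hj => by simp [hj, hj.trans (Nat.le_succ j)])
    (B := (Real.exp α - 1) * nnorm A α n x) (mul_nonneg hexp (nnorm_nonneg ..))
    (fun j hj => by
      have hstep : Real.exp (-α * j) = Real.exp α * Real.exp (-α * (j + 1 : ℕ)) := by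
        rw [← Real.exp_add]
        push_cast
        ring_nf
      rw [min_eq_left hj.le, min_eq_left (Nat.succ_le_of_lt hj), hstep]
      have heq : (1 - Real.exp α * Real.exp (-α * (j + 1 : ℕ))) -
          (1 - Real.exp (-α * (j + 1 : ℕ))) =
          -((Real.exp α - 1) * Real.exp (-α * (j + 1 : ℕ))) := by ring
      rw [heq, abs_neg, abs_of_nonneg (mul_nonneg hexp (Real.exp_nonneg _)), mul_assoc]
      exact mul_le_mul_of_nonneg_left (hdecay (j + 1)) hexp) i
  have hle : Real.exp (-α * i) ≤ 1 :=
    Real.exp_le_one_iff.2 (by nlinarith [(Nat.cast_nonneg i : (0 : ℝ) ≤ i)])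
  simp only [min_self] at key
  rw [abs_of_nonneg (by linarith)] at key
  linarith [hdecay i]

/-- Exponential decay of the orbits in the norms `nnorm`. -/
lemma exp_mul_nnorm_evol_le {A : ℕ → E →L[ℝ] E} {α c : ℝ} {M : ℕ → ℝ} (hα0 : 0 ≤ α)
    (hbd : ∀ m n : ℕ, n ≤ m → ‖evol A n m‖ ≤ M n * Real.exp (α * ((m : ℝ) - (n : ℝ))))
    (hc : 0 < c)
    (hsurj : ∀ v, MemC00 A α v → ∃ u, MemC00 A α u ∧ Gmap A u = v)
    (hinv : ∀ u, MemC00 A α u → cnorm A α u ≤ c * cnorm A α (Gmap A u))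
    (n N : ℕ) (x : E) :
    Real.exp (1 / (2 * c) * N) * nnorm A α (n + N) (evol A n (n + N) x) ≤
      2 * ((c * (Real.exp α - 1) + 1) * nnorm A α n x) := by
  set γ : ℝ := 1 / (2 * c) with hγ
  have hγ0 : 0 < γ := by positivity
  set a : ℕ → ℝ := fun j => nnorm A α (n + j) (evol A n (n + j) x) with ha
  have ha0 : ∀ j, 0 ≤ a j := fun j => nnorm_nonneg ..
  have hγexp : 0 ≤ 1 - Real.exp (-γ) := by linarith [Real.exp_le_one_iff.2 (neg_nonpos.2 hγ0.le)]
  have hcγ : c * (1 - Real.exp (-γ)) ≤ 1 / 2 := by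
    calc c * (1 - Real.exp (-γ)) ≤ c * γ := by
          gcongr
          linarith [Real.add_one_le_exp (-γ)]
      _ = 1 / 2 := by
          rw [hγ]
          field_simp
  obtain ⟨k, hk, hmax⟩ := Finset.exists_max_image (Finset.range (N + 1))
    (fun j => Real.exp (γ * j) * a j) ⟨0, by simp⟩
  have hkN : k ≤ N := by simpa [Nat.lt_succ_iff] using hk
  have hS0 : 0 ≤ Real.exp (γ * k) * a k := mul_nonneg (Real.exp_nonneg _) (ha0 k)
  have key := abs_mul_nnorm_evol_le hc hsurj hinv n x
    (φ := fun j => Real.exp (γ * (min j N : ℕ)) - 1) (by simp) (N := N)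
    (fun j hj => by simp [hj, hj.trans (Nat.le_succ j)])
    (B := (1 - Real.exp (-γ)) * (Real.exp (γ * k) * a k)) (mul_nonneg hγexp hS0)
    (fun j hj => by
      have hstep : Real.exp (γ * j) = Real.exp (-γ) * Real.exp (γ * (j + 1 : ℕ)) := by
        rw [← Real.exp_add]
        push_cast
        ring_nf
      rw [min_eq_left hj.le, min_eq_left (Nat.succ_le_of_lt hj), hstep]
      have heq : (Real.exp (-γ) * Real.exp (γ * (j + 1 : ℕ)) - 1) -
          (Real.exp (γ * (j + 1 : ℕ)) - 1) =
          -((1 - Real.exp (-γ)) * Real.exp (γ * (j + 1 : ℕ))) := by ring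
      rw [heq, abs_neg, abs_of_nonneg (mul_nonneg hγexp (Real.exp_nonneg _)), mul_assoc]
      exact mul_le_mul_of_nonneg_left (hmax (j + 1) (by simpa using hj)) hγexp) k
  have hone : 1 ≤ Real.exp (γ * k) := Real.one_le_exp (by positivity)
  simp only [min_eq_left hkN] at key
  rw [abs_of_nonneg (by linarith), ← mul_assoc] at key
  change (Real.exp (γ * k) - 1) * a k ≤ _ at key
  have hhalf := mul_le_mul_of_nonneg_right hcγ hS0
  have hbdd : a k ≤ _ := nnorm_evol_le_const_mul hα0 hbd hc hsurj hinv n k x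
  have hNk := hmax N (by simp)
  change Real.exp (γ * N) * a N ≤ _
  linarith

/-- Under the hypotheses of Statement 4,
`‖A(m,n)‖ ≤ 2 (c_α(e^α - 1) + 1) M_n e^{-(m-n)/(2 c_α)}` for all `m ≥ n`;
in particular `A` is nonuniform exponentially stable. -/
theorem stmt6 (A : ℕ → E →L[ℝ] E) (α : ℝ) (hα0 : 0 ≤ α) (M : ℕ → ℝ)
    (hM : ∀ n, 0 < M n)
    (hbd : ∀ m n : ℕ, n ≤ m → ‖evol A n m‖ ≤ M n * Real.exp (α * ((m : ℝ) - (n : ℝ))))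
    (c : ℝ) (hc : 0 < c)
    (hsurj : ∀ v, MemC00 A α v → ∃ u, MemC00 A α u ∧ Gmap A u = v)
    (hinv : ∀ u, MemC00 A α u → cnorm A α u ≤ c * cnorm A α (Gmap A u)) :
    (∀ m n : ℕ, n ≤ m →
      ‖evol A n m‖ ≤ 2 * (c * (Real.exp α - 1) + 1) * M n *
        Real.exp (-(1 / (2 * c)) * ((m : ℝ) - (n : ℝ)))) ∧
    (∃ ν : ℝ, ν < 0 ∧ IsAdmissible A ν) := by
  have hK : 0 < c * (Real.exp α - 1) + 1 := by
    have : 0 ≤ Real.exp α - 1 := by linarith [Real.one_le_exp hα0]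
    positivity
  have hdecay : ∀ m n : ℕ, n ≤ m →
      ‖evol A n m‖ ≤ 2 * (c * (Real.exp α - 1) + 1) * M n *
        Real.exp (-(1 / (2 * c)) * ((m : ℝ) - (n : ℝ))) := by
    intro m n hnm
    obtain ⟨i, rfl⟩ := Nat.exists_eq_add_of_le hnm
    refine ContinuousLinearMap.opNorm_le_bound _
      (mul_nonneg (mul_pos (by positivity) (hM n)).le (Real.exp_nonneg _)) fun x => ?_
    have hi : -(1 / (2 * c)) * (((n + i : ℕ) : ℝ) - (n : ℝ)) = -(1 / (2 * c) * i) := by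
      push_cast
      ring
    rw [hi]
    calc ‖evol A n (n + i) x‖ ≤ nnorm A α (n + i) (evol A n (n + i) x) :=
          norm_le_nnorm hbd (n + i) _
      _ = Real.exp (-(1 / (2 * c) * i)) * (Real.exp (1 / (2 * c) * i) *
            nnorm A α (n + i) (evol A n (n + i) x)) := by
          rw [← mul_assoc, ← Real.exp_add]
          simp
      _ ≤ Real.exp (-(1 / (2 * c) * i)) *
            (2 * ((c * (Real.exp α - 1) + 1) * (M n * ‖x‖))) := by
          refine mul_le_mul_of_nonneg_left ?_ (Real.exp_nonneg _)
          refine (exp_mul_nnorm_evol_le hα0 hbd hc hsurj hinv n i x).trans ?_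
          gcongr
          exact nnorm_le hbd n x
      _ = _ := by ring
  refine ⟨hdecay, -(1 / (2 * c)), neg_neg_of_pos (by positivity), ?_⟩
  exact ⟨fun n => 2 * (c * (Real.exp α - 1) + 1) * M n,
    fun n => mul_pos (by positivity) (hM n), hdecay⟩
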